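/- Let Ω ⊆ ℝ^m be a domain and c > 0 a constant. Then every weak solution u of Δu = e^{cu} on Ω (so u ∈ L¹_loc(Ω), e^{cu} ∈ L¹_loc(Ω), and ∫_Ω u·Δφ = ∫_Ω e^{cu}·φ for all φ ∈ C_c^∞(Ω)) agrees almost everywhere with a C^∞ function on Ω that solves Δu = e^{cu} classically. -/

import Mathlib

open MeasureTheory

noncomputable section

/-- The Laplacian of `f : ℝ^m → ℝ`, as the sum of second partial derivatives. -/
def lap {m : ℕ} (f : EuclideanSpace ℝ (Fin m) → ℝ) (x : EuclideanSpace ℝ (Fin m)) : ℝ :=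
  ∑ i, fderiv ℝ (fderiv ℝ f) x (EuclideanSpace.single i 1) (EuclideanSpace.single i 1)

/-- `u` is a weak solution of `Δu = g` on the open set `Ω`: `u, g ∈ L¹_loc(Ω)` and
`∫_Ω u Δφ = ∫_Ω g φ` for every test function `φ ∈ C_c^∞(Ω)`. -/
def IsWeakSol {m : ℕ} (u g : EuclideanSpace ℝ (Fin m) → ℝ)
    (Ω : Set (EuclideanSpace ℝ (Fin m))) : Prop :=
  LocallyIntegrableOn u Ω ∧ LocallyIntegrableOn g Ω ∧
    ∀ φ : EuclideanSpace ℝ (Fin m) → ℝ,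
      ContDiff ℝ (⊤ : ℕ∞) φ → HasCompactSupport φ → tsupport φ ⊆ Ω →
        ∫ x in Ω, u x * lap φ x = ∫ x in Ω, g x * φ x

abbrev Eu (m : ℕ) := EuclideanSpace ℝ (Fin m)

lemma exists_kernel (m : ℕ) : ∃ ψ ρ : Eu m → ℝ, ContDiff ℝ (⊤ : ℕ∞) ψ ∧ ContDiff ℝ (⊤ : ℕ∞) ρ ∧
    (∀ y, 1 ≤ ‖y‖ → ψ y = 0) ∧ (∀ y, 1 ≤ ‖y‖ → ρ y = 0) ∧ (∀ y, 0 ≤ ψ y) ∧ (∫ y, ρ y = 1) ∧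
    ∀ y v, fderiv ℝ ψ y v = - (ρ y * inner ℝ y v) := by
  have hd : ∀ s : ℝ, HasDerivAt expNegInvGlue ((s⁻¹)^2 * expNegInvGlue s) s := by
    intro s
    have := expNegInvGlue.hasDerivAt_polynomial_eval_inv_mul 1 s
    simpa using this
  have hderiv : deriv expNegInvGlue = fun s => (s⁻¹)^2 * expNegInvGlue s :=
    funext fun s => (hd s).deriv
  have hsm : ContDiff ℝ (⊤ : ℕ∞) (fun s : ℝ => (s⁻¹)^2 * expNegInvGlue s) := by
    rw [← hderiv]
    have h : ContDiff ℝ ((⊤ : ℕ∞) : WithTop ℕ∞) expNegInvGlue := expNegInvGlue.contDiff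
    exact ((contDiff_infty_iff_deriv (𝕜 := ℝ)).1 h).2
  set ρ0 : Eu m → ℝ := fun y => 2 * (((1 - ‖y‖^2)⁻¹)^2 * expNegInvGlue (1 - ‖y‖^2)) with hρ0
  have hin : ContDiff ℝ (⊤ : ℕ∞) (fun y : Eu m => 1 - ‖y‖^2) := contDiff_const.sub (contDiff_norm_sq ℝ)
  have hρs : ContDiff ℝ (⊤ : ℕ∞) ρ0 := contDiff_const.mul (hsm.comp hin)
  have hz : ∀ y : Eu m, 1 ≤ ‖y‖ → expNegInvGlue (1 - ‖y‖^2) = 0 := by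
    intro y hy
    apply expNegInvGlue.zero_of_nonpos
    nlinarith
  have hρz : ∀ y, 1 ≤ ‖y‖ → ρ0 y = 0 := by
    intro y hy
    simp [hρ0, hz y hy]
  have hcs : HasCompactSupport ρ0 := by
    apply HasCompactSupport.intro (isCompact_closedBall (0 : Eu m) 1)
    intro y hy
    apply hρz
    simp at hy
    exact hy.le
  have hpos : 0 < ∫ y, ρ0 y := by
    apply Continuous.integral_pos_of_hasCompactSupport_nonneg_nonzero (x := 0) hρs.continuous hcs
    · intro y
      have := expNegInvGlue.nonneg (1 - ‖y‖^2)
      simp only [hρ0, Pi.zero_apply]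
      positivity
    · have := expNegInvGlue.pos_of_pos one_pos
      simp [hρ0]
  have hE : ContDiff ℝ (⊤ : ℕ∞) expNegInvGlue := expNegInvGlue.contDiff
  obtain ⟨Z, hZ⟩ : ∃ Z, Z = ∫ y, ρ0 y := ⟨_, rfl⟩
  rw [← hZ] at hpos
  refine ⟨fun y => Z⁻¹ * expNegInvGlue (1 - ‖y‖^2), fun y => Z⁻¹ * ρ0 y, ?_, ?_, ?_, ?_, ?_, ?_, ?_⟩
  · exact contDiff_const.mul (hE.comp hin)
  · exact contDiff_const.mul hρs
  · intro y hy; simp [hz y hy]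
  · intro y hy; simp [hρz y hy]
  · intro y
    have := expNegInvGlue.nonneg (1 - ‖y‖^2)
    positivity
  · rw [integral_const_mul, ← hZ]
    exact inv_mul_cancel₀ hpos.ne'
  · intro y v
    have h1 : HasFDerivAt (fun y : Eu m => 1 - ‖y‖^2) (-(2 • innerSL ℝ y)) y :=
      ((hasStrictFDerivAt_norm_sq y).hasFDerivAt).const_sub 1
    have h2 := ((hd (1 - ‖y‖^2)).comp_hasFDerivAt y h1).const_mul Z⁻¹
    have h3 : fderiv ℝ (fun y : Eu m => Z⁻¹ * expNegInvGlue (1 - ‖y‖^2)) y = _ := h2.fderiv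
    rw [h3]
    simp [hρ0]
    ring

section T
variable {m : ℕ} {P : Type} [MeasurableSpace P] {μ : Measure P}

lemma T_integrable {k : P → ℝ} (hk : Integrable k μ) {γ : P → Eu m} (hγ : AEStronglyMeasurable γ μ)
    {F : Type} [NormedAddCommGroup F] [NormedSpace ℝ F] {f : Eu m → F} (hf : Continuous f)
    (hc : HasCompactSupport f) (x : Eu m) : Integrable (fun p => k p • f (x + γ p)) μ := by
  obtain ⟨C, hC⟩ := hc.exists_bound_of_continuous hf
  refine hk.smul_bdd C ?_ ?_
  · exact (hf.comp (continuous_const.add continuous_id)).comp_aestronglyMeasurable hγ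
  · exact Filter.Eventually.of_forall fun p => hC _

lemma T_hasFDerivAt {k : P → ℝ} (hk : Integrable k μ) {γ : P → Eu m}
    (hγ : AEStronglyMeasurable γ μ)
    {F : Type} [NormedAddCommGroup F] [NormedSpace ℝ F] {f : Eu m → F} (hf : ContDiff ℝ 1 f)
    (hc : HasCompactSupport f) (x : Eu m) :
    HasFDerivAt (fun x => ∫ p, k p • f (x + γ p) ∂μ) (∫ p, k p • fderiv ℝ f (x + γ p) ∂μ) x := by
  have hf' : Continuous (fderiv ℝ f) := hf.continuous_fderiv (by simp)
  obtain ⟨C, hC⟩ := (hc.fderiv ℝ).exists_bound_of_continuous hf'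
  apply hasFDerivAt_integral_of_dominated_of_fderiv_le (s := Set.univ) (bound := fun p => ‖k p‖ * C)
    (F := fun x p => k p • f (x + γ p)) (F' := fun x p => k p • fderiv ℝ f (x + γ p))
    Filter.univ_mem
  · exact Filter.Eventually.of_forall fun x => (T_integrable hk hγ hf.continuous hc x).1
  · exact T_integrable hk hγ hf.continuous hc x
  · exact (T_integrable hk hγ hf' (hc.fderiv ℝ) x).1
  · refine Filter.Eventually.of_forall fun p x _ => ?_
    rw [norm_smul]
    exact mul_le_mul_of_nonneg_left (hC _) (norm_nonneg _)
  · exact hk.norm.mul_const C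
  · refine Filter.Eventually.of_forall fun p x _ => ?_
    have h := ((hf.differentiable (by simp)) (x + γ p)).hasFDerivAt
    exact ((hasFDerivAt_comp_add_right (γ p)).2 h).const_smul (k p)

lemma T_contDiff_nat {k : P → ℝ} (hk : Integrable k μ) {γ : P → Eu m}
    (hγ : AEStronglyMeasurable γ μ) (n : ℕ) :
    ∀ {F : Type} [NormedAddCommGroup F] [NormedSpace ℝ F] {f : Eu m → F} (_ : ContDiff ℝ n f)
    (_ : HasCompactSupport f),
    ContDiff ℝ n (fun x => ∫ p, k p • f (x + γ p) ∂μ) := by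
  induction n with
  | zero =>
    intro F _ _ f hf hc
    have hf0 : Continuous f := hf.continuous
    obtain ⟨C, hC⟩ := hc.exists_bound_of_continuous hf0
    rw [Nat.cast_zero, contDiff_zero]
    apply continuous_of_dominated (bound := fun p => ‖k p‖ * C)
    · exact fun x => (T_integrable hk hγ hf0 hc x).1
    · refine fun x => Filter.Eventually.of_forall fun p => ?_
      rw [norm_smul]
      exact mul_le_mul_of_nonneg_left (hC _) (norm_nonneg _)
    · exact hk.norm.mul_const C
    · refine Filter.Eventually.of_forall fun p => ?_
      fun_prop
  | succ n ih =>
    intro F _ _ f hf hc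
    push_cast at hf ⊢
    rw [contDiff_succ_iff_hasFDerivAt]
    have h1 : ContDiff ℝ 1 f := hf.of_le (by simp)
    refine ⟨_, ih (f := fderiv ℝ f) ?_ (hc.fderiv ℝ), fun x => T_hasFDerivAt hk hγ h1 hc x⟩
    exact (contDiff_succ_iff_fderiv.1 hf).2.2

lemma T_contDiff {k : P → ℝ} (hk : Integrable k μ) {γ : P → Eu m}
    (hγ : AEStronglyMeasurable γ μ) 
    {F : Type} [NormedAddCommGroup F] [NormedSpace ℝ F] {f : Eu m → F} (hf : ContDiff ℝ (⊤ : ℕ∞) f)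
    (hc : HasCompactSupport f) :
    ContDiff ℝ (⊤ : ℕ∞) (fun x => ∫ p, k p • f (x + γ p) ∂μ) := by
  rw [contDiff_infty]
  intro n
  exact T_contDiff_nat hk hγ n (hf.of_le (by exact_mod_cast le_top)) hc

lemma T_lap {k : P → ℝ} (hk : Integrable k μ) {γ : P → Eu m}
    (hγ : AEStronglyMeasurable γ μ) {f : Eu m → ℝ} (hf : ContDiff ℝ (⊤ : ℕ∞) f)
    (hc : HasCompactSupport f) (x : Eu m) :
    lap (fun x => ∫ p, k p • f (x + γ p) ∂μ) x = ∫ p, k p • lap f (x + γ p) ∂μ := by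
  have h1 : ContDiff ℝ (⊤ : ℕ∞) (fderiv ℝ f) := hf.fderiv_right (by simp)
  have h2 : ContDiff ℝ (⊤ : ℕ∞) (fderiv ℝ (fderiv ℝ f)) := h1.fderiv_right (by simp)
  have e1 : fderiv ℝ (fun x => ∫ p, k p • f (x + γ p) ∂μ) = 
      fun x => ∫ p, k p • fderiv ℝ f (x + γ p) ∂μ :=
    funext fun x => (T_hasFDerivAt hk hγ (hf.of_le (by exact_mod_cast le_top)) hc x).fderiv
  have e2 : fderiv ℝ (fun x => ∫ p, k p • fderiv ℝ f (x + γ p) ∂μ) x =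
      ∫ p, k p • fderiv ℝ (fderiv ℝ f) (x + γ p) ∂μ :=
    (T_hasFDerivAt hk hγ (h1.of_le (by exact_mod_cast le_top)) (hc.fderiv ℝ) x).fderiv
  have hI := T_integrable hk hγ h2.continuous ((hc.fderiv ℝ).fderiv ℝ) x
  unfold lap
  rw [e1, e2]
  simp_rw [Finset.smul_sum]
  rw [integral_finsetSum]
  · refine Finset.sum_congr rfl fun i _ => ?_
    rw [ContinuousLinearMap.integral_apply hI, ContinuousLinearMap.integral_apply]
    · rfl
    · exact hI.apply_continuousLinearMap _
  · intro i _
    exact (hI.apply_continuousLinearMap _).apply_continuousLinearMap _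
end T

section Adj
variable {m : ℕ} {P : Type} [MeasurableSpace P] {μ : Measure P} [SFinite μ]

lemma adj_integrable {k : P → ℝ} (hk : Integrable k μ) {γ : P → Eu m} (hγ : Measurable γ)
    {U : Eu m → ℝ} (hUm : Measurable U) (hU : Integrable U) :
    Integrable (fun z : Eu m × P => k z.2 * U (z.1 - γ z.2)) (volume.prod μ) := by
  have hm : AEStronglyMeasurable (fun z : Eu m × P => k z.2 * U (z.1 - γ z.2)) (volume.prod μ) := by
    apply AEStronglyMeasurable.mul hk.1.comp_snd
    apply Measurable.aestronglyMeasurable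
    fun_prop
  rw [integrable_prod_iff' hm]
  constructor
  · exact Filter.Eventually.of_forall fun p => (hU.comp_sub_right (γ p)).const_mul (k p)
  · have : (fun p => ∫ x, ‖k p * U (x - γ p)‖) = fun p => ‖k p‖ * ∫ x, ‖U x‖ := by
      funext p
      simp_rw [norm_mul]
      rw [integral_const_mul, integral_sub_right_eq_self (fun x => ‖U x‖)]
    simp only [this]
    exact hk.norm.mul_const _

lemma adj_eq {k : P → ℝ} (hk : Integrable k μ) {γ : P → Eu m} (hγ : Measurable γ)
    {U : Eu m → ℝ} (hUm : Measurable U) (hU : Integrable U) {φ : Eu m → ℝ} (hφ : Continuous φ)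
    (hc : HasCompactSupport φ) :
    ∫ x, φ x * (∫ p, k p * U (x - γ p) ∂μ) = ∫ x, U x * (∫ p, k p * φ (x + γ p) ∂μ) := by
  obtain ⟨C, hC⟩ := hc.exists_bound_of_continuous hφ
  have i1 : Integrable (fun z : Eu m × P => φ z.1 * (k z.2 * U (z.1 - γ z.2))) (volume.prod μ) := by
    refine (adj_integrable hk hγ hUm hU).bdd_mul (c := C) ?_ ?_
    · exact (hφ.measurable.comp measurable_fst).aestronglyMeasurable
    · exact Filter.Eventually.of_forall fun z => hC _
  have i2 : Integrable (fun z : Eu m × P => φ (z.1 + γ z.2) * (U z.1 * k z.2)) (volume.prod μ) := by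
    refine (hU.mul_prod hk).bdd_mul (c := C) ?_ ?_
    · apply Measurable.aestronglyMeasurable
      have := hφ.measurable
      fun_prop
    · exact Filter.Eventually.of_forall fun z => hC _
  simp_rw [← integral_const_mul]
  rw [integral_integral_swap i1]
  have i2' : Integrable (Function.uncurry fun (x : Eu m) (p : P) => U x * (k p * φ (x + γ p)))
      (volume.prod μ) := by
    refine i2.congr (Filter.Eventually.of_forall fun z => ?_)
    simp [Function.uncurry]; ring
  rw [integral_integral_swap i2']
  refine integral_congr_ae (Filter.Eventually.of_forall fun p => ?_)
  simp only
  rw [← integral_add_right_eq_self _ (γ p)]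
  refine integral_congr_ae (Filter.Eventually.of_forall fun x => ?_)
  simp; ring
end Adj

section Calc
variable {m : ℕ}

lemma fderiv_coord (L : Eu m →L[ℝ] ℝ) (y : Eu m) :
    L y = ∑ i, y i * L (EuclideanSpace.single i 1) := by
  have h : y = ∑ i, y i • EuclideanSpace.single i (1 : ℝ) := by
    have := (EuclideanSpace.basisFun (Fin m) ℝ).sum_repr y
    simpa using this.symm
  conv_lhs => rw [h]
  simp

lemma parts_aux {f g : Eu m → ℝ} (hf : ContDiff ℝ 1 f) (hg : ContDiff ℝ 1 g)
    (hc : HasCompactSupport f) (v : Eu m) :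
    ∫ x, f x * fderiv ℝ g x v = - ∫ x, fderiv ℝ f x v * g x := by
  have hf' : Continuous (fderiv ℝ f) := hf.continuous_fderiv (by simp)
  have hg' : Continuous (fderiv ℝ g) := hg.continuous_fderiv (by simp)
  have hfc := hf.continuous
  have hgc := hg.continuous
  apply integral_mul_fderiv_eq_neg_fderiv_mul_of_integrable
  · apply Continuous.integrable_of_hasCompactSupport (by fun_prop)
    exact (hc.fderiv_apply ℝ v).mul_right
  · apply Continuous.integrable_of_hasCompactSupport (by fun_prop)
    exact hc.mul_right
  · apply Continuous.integrable_of_hasCompactSupport (by fun_prop)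
    exact hc.mul_right
  · exact fun x _ => hf.differentiable (by simp) x
  · exact fun x _ => hg.differentiable (by simp) x

lemma contDiff_fd {f : Eu m → ℝ} (hf : ContDiff ℝ (⊤ : ℕ∞) f) (v : Eu m) :
    ContDiff ℝ (⊤ : ℕ∞) (fun x => fderiv ℝ f x v) :=
  (hf.fderiv_right (m := (⊤ : ℕ∞)) (by simp)).clm_apply contDiff_const

lemma fderiv_fd {f : Eu m → ℝ} (hf : ContDiff ℝ (⊤ : ℕ∞) f) (v w x : Eu m) :
    fderiv ℝ (fun x => fderiv ℝ f x v) x w = fderiv ℝ (fderiv ℝ f) x w v := by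
  have h1 : ContDiff ℝ (⊤ : ℕ∞) (fderiv ℝ f) := hf.fderiv_right (by simp)
  have h2 : DifferentiableAt ℝ (fderiv ℝ f) x := h1.differentiable (by simp) x
  rw [fderiv_clm_apply h2 (differentiableAt_const v)]
  simp

lemma one_le_infty : (1 : WithTop ℕ∞) ≤ ((⊤ : ℕ∞) : WithTop ℕ∞) := by exact_mod_cast le_top

lemma lap_continuous {f : Eu m → ℝ} (hf : ContDiff ℝ (⊤ : ℕ∞) f) : Continuous (lap f) := by
  have h1 : ContDiff ℝ (⊤ : ℕ∞) (fderiv ℝ f) := hf.fderiv_right (by simp)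
  have h2 : ContDiff ℝ (⊤ : ℕ∞) (fderiv ℝ (fderiv ℝ f)) := h1.fderiv_right (by simp)
  have := h2.continuous
  unfold lap
  fun_prop

lemma green {V φ : Eu m → ℝ} (hV : ContDiff ℝ (⊤ : ℕ∞) V) (hφ : ContDiff ℝ (⊤ : ℕ∞) φ)
    (hVc : HasCompactSupport V) (hc : HasCompactSupport φ) :
    ∫ x, V x * lap φ x = ∫ x, lap V x * φ x := by
  have key : ∀ f g : Eu m → ℝ, ContDiff ℝ (⊤ : ℕ∞) f → ContDiff ℝ (⊤ : ℕ∞) g →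
      HasCompactSupport f → 
      ∫ x, f x * lap g x = ∑ i, - ∫ x, fderiv ℝ f x (EuclideanSpace.single i 1) * 
        fderiv ℝ g x (EuclideanSpace.single i 1) := by
    intro f g hf hg hfc
    unfold lap
    simp_rw [Finset.mul_sum]
    have h1 : ContDiff ℝ (⊤ : ℕ∞) (fderiv ℝ g) := hg.fderiv_right (by simp)
    have h2 : ContDiff ℝ (⊤ : ℕ∞) (fderiv ℝ (fderiv ℝ g)) := h1.fderiv_right (by simp)
    have c2 := h2.continuous
    have c0 := hf.continuous
    rw [integral_finsetSum]
    · refine Finset.sum_congr rfl fun i _ => ?_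
      rw [← parts_aux (hf.of_le one_le_infty) ((contDiff_fd hg _).of_le one_le_infty) hfc]
      simp_rw [fderiv_fd hg]
    · intro i _
      exact Continuous.integrable_of_hasCompactSupport (by fun_prop) hfc.mul_right
  rw [key V φ hV hφ hVc]
  have : ∫ x, lap V x * φ x = ∫ x, φ x * lap V x := by simp_rw [mul_comm]
  rw [this, key φ V hφ hV hc]
  simp_rw [mul_comm]

lemma parts_kernel {ψ ρ φ : Eu m → ℝ} (hψ : ContDiff ℝ (⊤ : ℕ∞) ψ)
    (hψc : HasCompactSupport ψ)
    (hψρ : ∀ y v, fderiv ℝ ψ y v = - (ρ y * inner ℝ y v)) (hφ : ContDiff ℝ (⊤ : ℕ∞) φ)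
    (x : Eu m) (t : ℝ) :
    ∫ y, ρ y * fderiv ℝ φ (x + t • y) y = t * ∫ y, ψ y * lap φ (x + t • y) := by
  have h1 : ContDiff ℝ (⊤ : ℕ∞) (fderiv ℝ φ) := hφ.fderiv_right (by simp)
  have h2 : ContDiff ℝ (⊤ : ℕ∞) (fderiv ℝ (fderiv ℝ φ)) := h1.fderiv_right (by simp)
  have c1 := h1.continuous
  have c2 := h2.continuous
  have c0 := hψ.continuous
  have cψ : Continuous (fderiv ℝ ψ) := hψ.continuous_fderiv (by simp)
  have e : ∀ y, ρ y * fderiv ℝ φ (x + t • y) y = ∑ i, - (fderiv ℝ ψ y (EuclideanSpace.single i 1) *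
      fderiv ℝ φ (x + t • y) (EuclideanSpace.single i 1)) := by
    intro y
    rw [fderiv_coord (fderiv ℝ φ (x + t • y)) y, Finset.mul_sum]
    refine Finset.sum_congr rfl fun i _ => ?_
    rw [hψρ]
    simp [EuclideanSpace.inner_single_right]
    ring
  simp_rw [e]
  unfold lap
  simp_rw [Finset.mul_sum]
  rw [integral_finsetSum, integral_finsetSum, Finset.mul_sum]
  · refine Finset.sum_congr rfl fun i _ => ?_
    have hin : ContDiff ℝ (⊤ : ℕ∞) (fun y : Eu m => x + t • y) := by fun_prop
    have hg : ContDiff ℝ (⊤ : ℕ∞) (fun y => fderiv ℝ φ (x + t • y) (EuclideanSpace.single i 1)) :=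
      (contDiff_fd hφ (EuclideanSpace.single i 1)).comp hin
    rw [integral_neg, ← parts_aux (hψ.of_le one_le_infty) (hg.of_le one_le_infty) hψc,
      ← integral_const_mul]
    refine integral_congr_ae (Filter.Eventually.of_forall fun y => ?_)
    simp only
    have hd : HasFDerivAt (fun y : Eu m => x + t • y) (t • ContinuousLinearMap.id ℝ (Eu m)) y :=
      ((hasFDerivAt_id y).const_smul t).const_add x
    have hh := ((contDiff_fd hφ (EuclideanSpace.single i 1)).differentiable (by simp)
      (x + t • y)).hasFDerivAt
    have h3 : fderiv ℝ (fun y => fderiv ℝ φ (x + t • y) (EuclideanSpace.single i 1)) y = _ :=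
      (HasFDerivAt.comp (g := fun z => fderiv ℝ φ z (EuclideanSpace.single i 1)) y hh hd).fderiv
    rw [h3]
    simp [fderiv_fd hφ]
    ring
  · intro i _
    exact Continuous.integrable_of_hasCompactSupport (by fun_prop) hψc.mul_right
  · intro i _
    refine Integrable.neg ?_
    exact Continuous.integrable_of_hasCompactSupport (by fun_prop)
      (hψc.fderiv_apply ℝ _).mul_right

lemma ftc_kernel {ψ ρ φ : Eu m → ℝ} (hψ : ContDiff ℝ (⊤ : ℕ∞) ψ) (hρ : ContDiff ℝ (⊤ : ℕ∞) ρ)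
    (hψc : HasCompactSupport ψ) (hρc : HasCompactSupport ρ) (hρ1 : ∫ y, ρ y = 1)
    (hψρ : ∀ y v, fderiv ℝ ψ y v = - (ρ y * inner ℝ y v)) (hφ : ContDiff ℝ (⊤ : ℕ∞) φ)
    (hφc : HasCompactSupport φ) (x : Eu m) {r : ℝ} (hr : 0 < r) :
    ∫ p : ℝ × Eu m, (p.1 * ψ p.2) • lap φ (x + p.1 • p.2)
      ∂((volume.restrict (Set.Ioc 0 r)).prod volume) = (∫ y, ρ y * φ (x + r • y)) - φ x := by
  have h1 : ContDiff ℝ (⊤ : ℕ∞) (fderiv ℝ φ) := hφ.fderiv_right (by simp)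
  have c1 := h1.continuous
  have c0 := hφ.continuous
  have cρ := hρ.continuous
  have cψ := hψ.continuous
  have cl := lap_continuous hφ
  have hlc : HasCompactSupport (lap φ) := by
    unfold lap
    apply HasCompactSupport.intro hφc
    intro y hy
    have : fderiv ℝ (fderiv ℝ φ) y = 0 := by
      apply image_eq_zero_of_notMem_tsupport
      intro h
      exact hy (tsupport_fderiv_subset ℝ (tsupport_fderiv_subset ℝ h))
    simp [this]
  obtain ⟨C, hC⟩ := (hφc.fderiv ℝ).exists_bound_of_continuous c1
  obtain ⟨D, hD⟩ := hlc.exists_bound_of_continuous cl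
  have hder : ∀ t : ℝ, HasDerivAt (fun t : ℝ => ∫ y, ρ y * φ (x + t • y))
      (t * ∫ y, ψ y * lap φ (x + t • y)) t := by
    intro t
    rw [← parts_kernel hψ hψc hψρ hφ]
    refine (hasDerivAt_integral_of_dominated_loc_of_deriv_le (s := Set.univ)
      (F := fun (t : ℝ) (y : Eu m) => ρ y * φ (x + t • y))
      (F' := fun (t : ℝ) (y : Eu m) => ρ y * fderiv ℝ φ (x + t • y) y)
      (bound := fun y => ‖ρ y‖ * (C * ‖y‖)) Filter.univ_mem ?_ ?_ ?_ ?_ ?_ ?_).2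
    · exact Filter.Eventually.of_forall fun s => Continuous.aestronglyMeasurable (by fun_prop)
    · exact Continuous.integrable_of_hasCompactSupport (by fun_prop) hρc.mul_right
    · exact Continuous.aestronglyMeasurable (by fun_prop)
    · refine Filter.Eventually.of_forall fun y s _ => ?_
      rw [norm_mul]
      refine mul_le_mul_of_nonneg_left ?_ (norm_nonneg _)
      refine (ContinuousLinearMap.le_opNorm _ _).trans ?_
      exact mul_le_mul_of_nonneg_right (hC _) (norm_nonneg _)
    · exact Continuous.integrable_of_hasCompactSupport (by fun_prop) hρc.norm.mul_right
    · refine Filter.Eventually.of_forall fun y s _ => ?_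
      have h3 : HasDerivAt (fun s : ℝ => x + s • y) y s := by
        simpa using ((hasDerivAt_id s).smul_const y).const_add x
      have h4 := (hφ.differentiable (by simp) (x + s • y)).hasFDerivAt
      exact (h4.comp_hasDerivAt s h3).const_mul (ρ y)
  have hcont : Continuous (fun t : ℝ => t * ∫ y, ψ y * lap φ (x + t • y)) := by
    refine continuous_id.mul (continuous_of_dominated (bound := fun y => ‖ψ y‖ * D) ?_ ?_ ?_ ?_)
    · exact fun t => Continuous.aestronglyMeasurable (by fun_prop)
    · refine fun t => Filter.Eventually.of_forall fun y => ?_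
      rw [norm_mul]
      exact mul_le_mul_of_nonneg_left (hD _) (norm_nonneg _)
    · exact (cψ.integrable_of_hasCompactSupport hψc).norm.mul_const D
    · exact Filter.Eventually.of_forall fun y => by fun_prop
  have hftc := intervalIntegral.integral_eq_sub_of_hasDerivAt (a := 0) (b := r)
    (fun t _ => hder t) (hcont.intervalIntegrable _ _)
  rw [intervalIntegral.integral_of_le hr.le] at hftc
  have e0 : ∫ y, ρ y * φ (x + (0 : ℝ) • y) = φ x := by
    simp [integral_mul_const, hρ1]
  rw [e0] at hftc
  rw [← hftc, integral_prod]
  · refine integral_congr_ae (Filter.Eventually.of_forall fun t => ?_)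
    simp only [smul_eq_mul, mul_assoc]
    rw [integral_const_mul]
  · apply T_integrable (γ := fun p : ℝ × Eu m => p.1 • p.2) (k := fun p => p.1 * ψ p.2)
    · apply Integrable.mul_prod (f := fun t : ℝ => t)
      · exact (continuous_id.integrableOn_Icc).mono_set Set.Ioc_subset_Icc_self
      · exact cψ.integrable_of_hasCompactSupport hψc
    · apply Measurable.aestronglyMeasurable
      fun_prop
    · exact cl
    · exact hlc
end Calc

structure IsKer {m : ℕ} (ψ ρ : Eu m → ℝ) : Prop where
  sψ : ContDiff ℝ (⊤ : ℕ∞) ψ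
  sρ : ContDiff ℝ (⊤ : ℕ∞) ρ
  zψ : ∀ y, 1 ≤ ‖y‖ → ψ y = 0
  zρ : ∀ y, 1 ≤ ‖y‖ → ρ y = 0
  nn : ∀ y, 0 ≤ ψ y
  one : ∫ y, ρ y = 1
  grad : ∀ y v, fderiv ℝ ψ y v = - (ρ y * inner ℝ y v)

lemma hcs_of {m : ℕ} {f : Eu m → ℝ} (h : ∀ y, 1 ≤ ‖y‖ → f y = 0) : HasCompactSupport f := by
  apply HasCompactSupport.intro (isCompact_closedBall (0 : Eu m) 1)
  intro y hy
  apply h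
  simp at hy
  exact hy.le

lemma IsKer.cψ {m : ℕ} {ψ ρ : Eu m → ℝ} (h : IsKer ψ ρ) : HasCompactSupport ψ := hcs_of h.zψ
lemma IsKer.cρ {m : ℕ} {ψ ρ : Eu m → ℝ} (h : IsKer ψ ρ) : HasCompactSupport ρ := hcs_of h.zρ

/-- the measure `dt dy` on `(0,r] × ℝ^m` -/
abbrev pm (m : ℕ) (r : ℝ) : Measure (ℝ × Eu m) :=
  (volume.restrict (Set.Ioc 0 r)).prod volume

lemma ae_pm (m : ℕ) (r : ℝ) : ∀ᵐ p ∂(pm m r), p.1 ∈ Set.Ioc 0 r := by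
  have h : ∀ᵐ t ∂(volume.restrict (Set.Ioc (0:ℝ) r)), t ∈ Set.Ioc 0 r :=
    ae_restrict_mem measurableSet_Ioc
  exact (Measure.quasiMeasurePreserving_fst (μ := volume.restrict (Set.Ioc (0:ℝ) r))
    (ν := (volume : Measure (Eu m)))).ae h

lemma IsKer.int_k {m : ℕ} {ψ ρ : Eu m → ℝ} (h : IsKer ψ ρ) (r : ℝ) :
    Integrable (fun p : ℝ × Eu m => p.1 * ψ p.2) (pm m r) := by
  apply Integrable.mul_prod (f := fun t : ℝ => t)
  · exact (continuous_id.integrableOn_Icc).mono_set Set.Ioc_subset_Icc_self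
  · exact h.sψ.continuous.integrable_of_hasCompactSupport h.cψ

lemma IsKer.int_ρ {m : ℕ} {ψ ρ : Eu m → ℝ} (h : IsKer ψ ρ) : Integrable ρ :=
  h.sρ.continuous.integrable_of_hasCompactSupport h.cρ

lemma rep {m : ℕ} {ψ ρ : Eu m → ℝ} (hK : IsKer ψ ρ) {U F : Eu m → ℝ} (hUm : Measurable U)
    (hU : Integrable U) (hFm : Measurable F) (hF : Integrable F) {x0 : Eu m} {S : ℝ} (_hS : 0 < S)
    (hw : ∀ φ : Eu m → ℝ, ContDiff ℝ (⊤ : ℕ∞) φ → HasCompactSupport φ →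
      tsupport φ ⊆ Metric.ball x0 S → ∫ x, U x * lap φ x = ∫ x, F x * φ x) {r : ℝ} (hr : 0 < r)
    (hrS : r ≤ S / 3) :
    ∀ᵐ x, x ∈ Metric.ball x0 (S / 3) → U x = (∫ y, ρ y * U (x - r • y)) -
      ∫ p, (p.1 * ψ p.2) * F (x - p.1 • p.2) ∂(pm m r) := by
  have mγ1 : Measurable (fun y : Eu m => r • y) := by fun_prop
  have mγ2 : Measurable (fun p : ℝ × Eu m => p.1 • p.2) := by fun_prop
  have I1 : Integrable (fun x => ∫ y, ρ y * U (x - r • y)) :=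
    (adj_integrable hK.int_ρ mγ1 hUm hU).integral_prod_left
  have I2 : Integrable (fun x => ∫ p, (p.1 * ψ p.2) * F (x - p.1 • p.2) ∂(pm m r)) :=
    (adj_integrable (hK.int_k r) mγ2 hFm hF).integral_prod_left
  have main := (Metric.isOpen_ball (x := x0) (ε := S/3)).ae_eq_zero_of_integral_contDiff_smul_eq_zero
    (f := fun x => U x - (∫ y, ρ y * U (x - r • y)) +
      ∫ p, (p.1 * ψ p.2) * F (x - p.1 • p.2) ∂(pm m r)) (μ := volume)
    (((hU.sub I1).add I2).locallyIntegrable.locallyIntegrableOn _) ?_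
  · filter_upwards [main] with x hx hxb
    have := hx hxb
    linarith
  intro g hg hgc hgs
  have cg := hg.continuous
  obtain ⟨C, hC⟩ := hgc.exists_bound_of_continuous cg
  have bm : ∀ f : Eu m → ℝ, Integrable f → Integrable (fun x => g x * f x) := fun f hf =>
    hf.bdd_mul (c := C) cg.aestronglyMeasurable (Filter.Eventually.of_forall hC)
  have hζ := T_contDiff (hK.int_k r) mγ2.aestronglyMeasurable hg hgc
  have hlap : ∀ x, lap (fun x => ∫ p, (p.1 * ψ p.2) • g (x + p.1 • p.2) ∂(pm m r)) x =
      (∫ y, ρ y * g (x + r • y)) - g x := fun x =>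
    (T_lap (hK.int_k r) mγ2.aestronglyMeasurable hg hgc x).trans
      (ftc_kernel hK.sψ hK.sρ hK.cψ hK.cρ hK.one hK.grad hg hgc x hr)
  have hsupp : ∀ x, x ∉ Metric.closedBall x0 (2 * S / 3) → 
      ∫ p, (p.1 * ψ p.2) • g (x + p.1 • p.2) ∂(pm m r) = 0 := by
    intro x hx
    apply integral_eq_zero_of_ae
    filter_upwards [ae_pm m r] with p hp
    by_cases hy : 1 ≤ ‖p.2‖
    · simp [hK.zψ _ hy]
    · have : g (x + p.1 • p.2) = 0 := by
        apply image_eq_zero_of_notMem_tsupport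
        intro h
        have h1 := hgs h
        rw [Metric.mem_ball, dist_eq_norm] at h1
        rw [Metric.mem_closedBall, dist_eq_norm, not_le] at hx
        have h2 : ‖p.1 • p.2‖ ≤ S / 3 := by
          rw [norm_smul, Real.norm_of_nonneg hp.1.le]
          nlinarith [hp.1, hp.2, norm_nonneg p.2]
        have h3 : x - x0 = (x + p.1 • p.2 - x0) - p.1 • p.2 := by abel
        have h4 := norm_sub_le (x + p.1 • p.2 - x0) (p.1 • p.2)
        rw [← h3] at h4
        linarith
      simp [this]
  have hζc : HasCompactSupport (fun x => ∫ p, (p.1 * ψ p.2) • g (x + p.1 • p.2) ∂(pm m r)) :=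
    HasCompactSupport.intro (isCompact_closedBall x0 (2 * S / 3)) hsupp
  have hζs : tsupport (fun x => ∫ p, (p.1 * ψ p.2) • g (x + p.1 • p.2) ∂(pm m r)) ⊆
      Metric.ball x0 S := by
    refine subset_trans (closure_minimal ?_ Metric.isClosed_closedBall)
      (Metric.closedBall_subset_ball (show 2 * S / 3 < S by linarith))
    intro x hx
    by_contra h
    exact hx (hsupp x h)
  have hweak := hw _ hζ hζc hζs
  simp_rw [hlap] at hweak
  have a1 := adj_eq hK.int_ρ mγ1 hUm hU cg hgc
  have a2 := adj_eq (hK.int_k r) mγ2 hFm hF cg hgc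
  have I3 : Integrable (fun x => U x * ∫ y, ρ y * g (x + r • y)) := by
    refine hU.mul_bdd (c := ∫ y, ‖ρ y‖ * C) ?_ ?_
    · have := T_contDiff hK.int_ρ mγ1.aestronglyMeasurable hg hgc
      exact this.continuous.aestronglyMeasurable
    · refine Filter.Eventually.of_forall fun x => ?_
      refine norm_integral_le_of_norm_le (hK.int_ρ.norm.mul_const C) ?_
      refine Filter.Eventually.of_forall fun y => ?_
      rw [norm_mul]
      exact mul_le_mul_of_nonneg_left (hC _) (norm_nonneg _)
  have I4 : Integrable (fun x => U x * g x) := by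
    simpa only [mul_comm] using bm U hU
  simp_rw [mul_sub] at hweak
  rw [integral_sub I3 I4] at hweak
  simp only [smul_eq_mul, mul_add, mul_sub] at hweak ⊢
  have I5 : Integrable (fun x => g x * U x - g x * ∫ y, ρ y * U (x - r • y)) :=
    (bm _ hU).sub (bm _ I1)
  rw [integral_add I5 (bm _ I2), integral_sub (bm _ hU) (bm _ I1), a1, a2,
    ← hweak]
  simp_rw [mul_comm (g _) (U _)]
  ring

section Smooth
variable {m : ℕ}

lemma scal {G : Type} [NormedAddCommGroup G] [NormedSpace ℝ G] (κ : Eu m → G) (F : Eu m → ℝ)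
    {t : ℝ} (ht : 0 < t) (x : Eu m) :
    ∫ y, F (x - t • y) • κ y = |(t ^ Module.finrank ℝ (Eu m))⁻¹| •
      ∫ z, F z • κ (t⁻¹ • (x - z)) := by
  have h1 := Measure.integral_comp_smul (volume : Measure (Eu m))
    (fun w => F (x - w) • κ (t⁻¹ • w)) t
  simp only [smul_smul, inv_mul_cancel₀ ht.ne', one_smul] at h1
  rw [h1, ← integral_sub_left_eq_self _ _ x]
  simp

lemma conv_eq (κ : Eu m → ℝ) (F : Eu m → ℝ) {t : ℝ} (ht : 0 < t) :
    (fun x => ∫ y, κ y * F (x - t • y)) = fun x => |(t ^ Module.finrank ℝ (Eu m))⁻¹| *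
      (convolution F (fun w => κ (t⁻¹ • w)) (ContinuousLinearMap.lsmul ℝ ℝ) volume) x := by
  funext x
  have := scal κ F ht x
  simp only [smul_eq_mul] at this
  simp_rw [mul_comm (κ _)]
  rw [this]
  rfl

lemma hcs_scale {κ : Eu m → ℝ} (hκ : HasCompactSupport κ) {t : ℝ} (ht : 0 < t) :
    HasCompactSupport (fun w => κ (t⁻¹ • w)) :=
  hκ.comp_smul (inv_ne_zero ht.ne')

lemma conv_smooth {κ : Eu m → ℝ} (hκ : ContDiff ℝ (⊤ : ℕ∞) κ) (hc : HasCompactSupport κ)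
    {F : Eu m → ℝ} (hF : Integrable F) {t : ℝ} (ht : 0 < t) :
    ContDiff ℝ (⊤ : ℕ∞) (fun x => ∫ y, κ y * F (x - t • y)) := by
  rw [conv_eq κ F ht]
  refine contDiff_const.mul ?_
  apply (hcs_scale hc ht).contDiff_convolution_right _ hF.locallyIntegrable
  exact hκ.comp (contDiff_const_smul _)

lemma inner_hasFDerivAt {κ : Eu m → ℝ} (hκ : ContDiff ℝ (⊤ : ℕ∞) κ) (hc : HasCompactSupport κ)
    {F : Eu m → ℝ} (hF : Integrable F) {t : ℝ} (ht : 0 < t) (x : Eu m) :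
    HasFDerivAt (fun x => ∫ y, κ y * F (x - t • y)) (t⁻¹ • ∫ y, F (x - t • y) • fderiv ℝ κ y) x := by
  rw [conv_eq κ F ht]
  have hg : ContDiff ℝ (⊤ : ℕ∞) (fun w => κ (t⁻¹ • w)) := hκ.comp (contDiff_const_smul _)
  have h := ((hcs_scale hc ht).hasFDerivAt_convolution_right (μ := volume) 
    (ContinuousLinearMap.lsmul ℝ ℝ) hF.locallyIntegrable (hg.of_le one_le_infty) x).const_mul 
    |(t ^ Module.finrank ℝ (Eu m))⁻¹|
  refine h.congr_fderiv (Eq.symm ?_)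
  rw [scal _ F ht x, smul_comm]
  congr 1
  rw [← integral_smul]
  unfold convolution
  refine integral_congr_ae (Filter.Eventually.of_forall fun z => ?_)
  have hd : HasFDerivAt (fun w : Eu m => κ (t⁻¹ • w)) 
      ((fderiv ℝ κ (t⁻¹ • (x - z))).comp (t⁻¹ • ContinuousLinearMap.id ℝ (Eu m))) (x - z) := by
    have h1 := (hκ.differentiable (by simp) (t⁻¹ • (x - z))).hasFDerivAt
    exact HasFDerivAt.comp (g := κ) (x - z) h1 ((hasFDerivAt_id (x - z)).const_smul t⁻¹)
  simp only [hd.fderiv]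
  ext v
  simp

lemma A_hasFDerivAt {ψ ρ : Eu m → ℝ} (hK : IsKer ψ ρ) {F : Eu m → ℝ} (hFm : Measurable F)
    (hF : Integrable F) {D : ℝ} (hD : ∀ x, ‖F x‖ ≤ D) (r : ℝ) (x : Eu m) :
    HasFDerivAt (fun x => ∫ p, (p.1 * ψ p.2) * F (x - p.1 • p.2) ∂(pm m r))
      (∫ p, F (x - p.1 • p.2) • fderiv ℝ ψ p.2 ∂(pm m r)) x := by
  have cψ' : Continuous (fderiv ℝ ψ) := hK.sψ.continuous_fderiv (by simp)
  have iψ' : Integrable (fderiv ℝ ψ) := cψ'.integrable_of_hasCompactSupport (hK.cψ.fderiv ℝ)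
  have e1 : (fun x => ∫ p, (p.1 * ψ p.2) * F (x - p.1 • p.2) ∂(pm m r)) =
      fun x => ∫ t in Set.Ioc 0 r, t * ∫ y, ψ y * F (x - t • y) := by
    funext x
    rw [integral_prod]
    · simp_rw [mul_assoc, integral_const_mul]
    · refine (hK.int_k r).mul_bdd (c := D) ?_ (Filter.Eventually.of_forall fun p => hD _)
      exact (hFm.comp (by fun_prop)).aestronglyMeasurable
  have i2 : ∀ x, Integrable (fun p : ℝ × Eu m => F (x - p.1 • p.2) • fderiv ℝ ψ p.2) (pm m r) := by
    intro x
    refine Integrable.bdd_smul (φ := fun p : ℝ × Eu m => F (x - p.1 • p.2))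
      (f := fun p : ℝ × Eu m => fderiv ℝ ψ p.2) ?_ D ?_ (Filter.Eventually.of_forall fun p => hD _)
    · exact iψ'.comp_snd _
    · exact (hFm.comp (by fun_prop)).aestronglyMeasurable
  rw [e1, integral_prod _ (i2 x)]
  apply hasFDerivAt_integral_of_dominated_of_fderiv_le (s := Set.univ)
    (bound := fun _ => ∫ y, D * ‖fderiv ℝ ψ y‖)
    (F := fun x t => t * ∫ y, ψ y * F (x - t • y)) 
    (F' := fun x t => ∫ y, F (x - t • y) • fderiv ℝ ψ y)
    Filter.univ_mem
  · refine Filter.Eventually.of_forall fun x => ?_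
    apply StronglyMeasurable.aestronglyMeasurable
    refine StronglyMeasurable.mul stronglyMeasurable_id ?_
    have : StronglyMeasurable (fun p : ℝ × Eu m => ψ p.2 * F (x - p.1 • p.2)) := by
      have := hK.sψ.continuous.measurable
      apply Measurable.stronglyMeasurable
      fun_prop
    exact this.integral_prod_right'
  · have : Integrable (fun p : ℝ × Eu m => (p.1 * ψ p.2) * F (x - p.1 • p.2)) (pm m r) := by
      refine (hK.int_k r).mul_bdd (c := D) ?_ (Filter.Eventually.of_forall fun p => hD _)
      exact (hFm.comp (by fun_prop)).aestronglyMeasurable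
    have := this.integral_prod_left
    simpa only [mul_assoc, integral_const_mul] using this
  · exact (i2 x).integral_prod_left.1
  · refine Filter.Eventually.of_forall fun t x _ => ?_
    refine norm_integral_le_of_norm_le (iψ'.norm.const_mul D) ?_
    refine Filter.Eventually.of_forall fun y => ?_
    rw [norm_smul]
    exact mul_le_mul_of_nonneg_right (hD _) (norm_nonneg _)
  · exact integrable_const _
  · filter_upwards [ae_restrict_mem measurableSet_Ioc] with t ht x _
    have := (inner_hasFDerivAt hK.sψ hK.cψ hF ht.1 x).const_mul t
    rwa [smul_smul, mul_inv_cancel₀ ht.1.ne', one_smul] at this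

lemma A_contDiff {ψ ρ : Eu m → ℝ} (hK : IsKer ψ ρ) {F : Eu m → ℝ} {n : ℕ} (hF : ContDiff ℝ n F)
    (hc : HasCompactSupport F) (r : ℝ) : 
    ContDiff ℝ (n + 1) (fun x => ∫ p, (p.1 * ψ p.2) * F (x - p.1 • p.2) ∂(pm m r)) := by
  have cF := hF.continuous
  obtain ⟨D, hD⟩ := hc.exists_bound_of_continuous cF
  have cψ' : Continuous (fderiv ℝ ψ) := hK.sψ.continuous_fderiv (by simp)
  have iψ' : Integrable (fderiv ℝ ψ) := cψ'.integrable_of_hasCompactSupport (hK.cψ.fderiv ℝ)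
  have hd := A_hasFDerivAt hK cF.measurable (cF.integrable_of_hasCompactSupport hc) hD r
  rw [contDiff_succ_iff_fderiv_apply]
  refine ⟨fun x => (hd x).differentiableAt, by simp, fun v => ?_⟩
  have i2 : ∀ x, Integrable (fun p : ℝ × Eu m => F (x - p.1 • p.2) • fderiv ℝ ψ p.2) (pm m r) := by
    intro x
    refine Integrable.bdd_smul (φ := fun p : ℝ × Eu m => F (x - p.1 • p.2))
      (f := fun p : ℝ × Eu m => fderiv ℝ ψ p.2) ?_ D ?_ (Filter.Eventually.of_forall fun p => hD _)
    · exact iψ'.comp_snd _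
    · exact (cF.measurable.comp (by fun_prop)).aestronglyMeasurable
  have e : (fun x => fderiv ℝ (fun x => ∫ p, (p.1 * ψ p.2) * F (x - p.1 • p.2) ∂(pm m r)) x v) =
      fun x => ∫ p, (fderiv ℝ ψ p.2 v) • F (x + -(p.1 • p.2)) ∂(pm m r) := by
    funext x
    rw [(hd x).fderiv, ContinuousLinearMap.integral_apply (i2 x)]
    simp [mul_comm, sub_eq_add_neg]
  rw [e]
  refine T_contDiff_nat (k := fun p : ℝ × Eu m => fderiv ℝ ψ p.2 v)
    (γ := fun p : ℝ × Eu m => -(p.1 • p.2)) ?_ ?_ n hF hc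
  · exact (iψ'.apply_continuousLinearMap v).comp_snd _
  · apply Measurable.aestronglyMeasurable
    fun_prop
end Smooth

section Main
variable {m : ℕ}

lemma lap_zero {φ : Eu m → ℝ} {x : Eu m} (h : x ∉ tsupport φ) : lap φ x = 0 := by
  have : fderiv ℝ (fderiv ℝ φ) x = 0 := by
    apply image_eq_zero_of_notMem_tsupport
    intro h'
    exact h (tsupport_fderiv_subset ℝ (tsupport_fderiv_subset ℝ h'))
  simp [lap, this]

lemma weak_local {Ω : Set (Eu m)} {u f : Eu m → ℝ} (hw : IsWeakSol u f Ω) {x0 : Eu m} {S : ℝ}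
    (hS : Metric.ball x0 S ⊆ Ω) {U F : Eu m → ℝ}
    (hU : ∀ᵐ x, x ∈ Metric.ball x0 S → U x = u x) (hF : ∀ᵐ x, x ∈ Metric.ball x0 S → F x = f x)
    (φ : Eu m → ℝ) (h1 : ContDiff ℝ (⊤ : ℕ∞) φ) (h2 : HasCompactSupport φ)
    (h3 : tsupport φ ⊆ Metric.ball x0 S) : ∫ x, U x * lap φ x = ∫ x, F x * φ x := by
  have h := hw.2.2 φ h1 h2 (h3.trans hS)
  rw [setIntegral_eq_integral_of_forall_compl_eq_zero,
    setIntegral_eq_integral_of_forall_compl_eq_zero] at h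
  · have e1 : ∫ x, U x * lap φ x = ∫ x, u x * lap φ x := by
      apply integral_congr_ae
      filter_upwards [hU] with x hx
      by_cases hx' : x ∈ tsupport φ
      · rw [hx (h3 hx')]
      · simp [lap_zero hx']
    have e2 : ∫ x, F x * φ x = ∫ x, f x * φ x := by
      apply integral_congr_ae
      filter_upwards [hF] with x hx
      by_cases hx' : x ∈ tsupport φ
      · rw [hx (h3 hx')]
      · simp [image_eq_zero_of_notMem_tsupport hx']
    rw [e1, e2, h]
  · intro x hx
    rw [image_eq_zero_of_notMem_tsupport (fun h => hx (hS (h3 h))), mul_zero]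
  · intro x hx
    rw [lap_zero (fun h => hx (hS (h3 h))), mul_zero]

lemma local_cont {ψ ρ : Eu m → ℝ} (hK : IsKer ψ ρ) {Ω : Set (Eu m)} (hΩ : IsOpen Ω) {c : ℝ}
    (hc : 0 < c) {u : Eu m → ℝ} (hw : IsWeakSol u (fun x => Real.exp (c * u x)) Ω) (x0 : Eu m)
    (hx0 : x0 ∈ Ω) : ∃ s : ℝ, ∃ w : Eu m → ℝ, 0 < s ∧ Continuous w ∧ Metric.ball x0 s ⊆ Ω ∧
      ∀ᵐ x, x ∈ Metric.ball x0 s → u x = w x := by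
  obtain ⟨S, hS, hSΩ⟩ := Metric.nhds_basis_closedBall.mem_iff.1 (hΩ.mem_nhds hx0)
  have hbΩ : Metric.ball x0 S ⊆ Ω := Metric.ball_subset_closedBall.trans hSΩ
  have iu : IntegrableOn u (Metric.ball x0 S) :=
    (hw.1.integrableOn_compact_subset hSΩ (isCompact_closedBall x0 S)).mono_set
      Metric.ball_subset_closedBall
  have ie : IntegrableOn (fun x => Real.exp (c * u x)) (Metric.ball x0 S) :=
    (hw.2.1.integrableOn_compact_subset hSΩ (isCompact_closedBall x0 S)).mono_set
      Metric.ball_subset_closedBall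
  have mb : MeasurableSet (Metric.ball x0 S) := measurableSet_ball
  obtain ⟨g, hgm, hgu⟩ := iu.1
  have hgm := hgm.measurable
  have hgu' : ∀ᵐ x, x ∈ Metric.ball x0 S → u x = g x := (ae_restrict_iff' mb).1 hgu
  set U : Eu m → ℝ := (Metric.ball x0 S).indicator g with hUdef
  have hUm : Measurable U := hgm.indicator mb
  have hUu : ∀ᵐ x, x ∈ Metric.ball x0 S → U x = u x := by
    filter_upwards [hgu'] with x hx hb
    rw [hUdef, Set.indicator_of_mem hb, hx hb]
  have hU : Integrable U := by
    rw [hUdef, integrable_indicator_iff mb]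
    exact iu.congr hgu
  set F : Eu m → ℝ := (Metric.ball x0 S).indicator (fun x => Real.exp (c * g x)) with hFdef
  have hFm : Measurable F := by
    apply Measurable.indicator _ mb
    fun_prop
  have hFf : ∀ᵐ x, x ∈ Metric.ball x0 S → F x = Real.exp (c * u x) := by
    filter_upwards [hgu'] with x hx hb
    rw [hFdef, Set.indicator_of_mem hb, hx hb]
  have hF : Integrable F := by
    rw [hFdef, integrable_indicator_iff mb]
    refine ie.congr ?_
    filter_upwards [hgu] with x hx
    rw [hx]
  have hF0 : ∀ x, 0 ≤ F x := fun x => Set.indicator_nonneg (fun y _ => (Real.exp_pos _).le) x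
  have hS3 : 0 < S / 3 := by linarith
  have R1 := rep hK hUm hU hFm hF hS (weak_local hw hbΩ hUu hFf) hS3 le_rfl
  have cw1 := (conv_smooth hK.sρ hK.cρ hU hS3).continuous
  obtain ⟨M, hM⟩ := (isCompact_closedBall x0 (S/3)).exists_bound_of_continuousOn cw1.continuousOn
  have hUM : ∀ᵐ x, x ∈ Metric.ball x0 (S/3) → U x ≤ M := by
    filter_upwards [R1] with x hx hb
    have h1 := hM x (Metric.ball_subset_closedBall hb)
    have h2 : 0 ≤ ∫ p, (p.1 * ψ p.2) * F (x - p.1 • p.2) ∂(pm m (S/3)) := by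
      apply integral_nonneg_of_ae
      filter_upwards [ae_pm m (S/3)] with p hp
      exact mul_nonneg (mul_nonneg hp.1.le (hK.nn _)) (hF0 _)
    have h3 := le_of_abs_le h1
    rw [hx hb]
    linarith
  have hsub : Metric.ball x0 (S/3) ⊆ Metric.ball x0 S := Metric.ball_subset_ball (by linarith)
  set F2 : Eu m → ℝ := (Metric.ball x0 (S/3)).indicator
    (fun x => min (Real.exp (c * g x)) (Real.exp (c * M))) with hF2def
  have hF2m : Measurable F2 := by
    apply Measurable.indicator _ measurableSet_ball
    fun_prop
  have hF2D : ∀ x, ‖F2 x‖ ≤ Real.exp (c * M) := by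
    intro x
    rw [hF2def]
    refine (norm_indicator_le_norm_self _ _).trans ?_
    rw [Real.norm_of_nonneg (le_min (Real.exp_pos _).le (Real.exp_pos _).le)]
    exact min_le_right _ _
  have hF2 : Integrable F2 := by
    have : IntegrableOn F2 (Metric.ball x0 (S/3)) := by
      refine Measure.integrableOn_of_bounded (M := Real.exp (c * M)) measure_ball_lt_top.ne
        hF2m.aestronglyMeasurable (Filter.Eventually.of_forall hF2D)
    rw [hF2def] at this ⊢
    rw [integrable_indicator_iff measurableSet_ball]
    refine this.congr_fun ?_ measurableSet_ball
    intro x hx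
    simp only [Set.indicator_of_mem hx]
  have hF2f : ∀ᵐ x, x ∈ Metric.ball x0 (S/3) → F2 x = Real.exp (c * u x) := by
    filter_upwards [hgu', hUM, hUu] with x h1 h2 h3 hb
    have h4 := h2 hb
    rw [h3 (hsub hb)] at h4
    rw [hF2def, Set.indicator_of_mem hb, ← h1 (hsub hb), min_eq_left]
    exact Real.exp_le_exp.2 (mul_le_mul_of_nonneg_left h4 hc.le)
  have hUu2 : ∀ᵐ x, x ∈ Metric.ball x0 (S/3) → U x = u x := by
    filter_upwards [hUu] with x h hb using h (hsub hb)
  have hS9 : 0 < S / 3 / 3 := by linarith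
  have R2 := rep hK hUm hU hF2m hF2 hS3 (weak_local hw (hsub.trans hbΩ) hUu2 hF2f) hS9 le_rfl
  have hsub2 : Metric.ball x0 (S/3/3) ⊆ Metric.ball x0 (S/3) :=
    Metric.ball_subset_ball (by linarith)
  refine ⟨S/3/3, fun x => (∫ y, ρ y * U (x - (S/3/3) • y)) -
      ∫ p, (p.1 * ψ p.2) * F2 (x - p.1 • p.2) ∂(pm m (S/3/3)), hS9, ?_, 
      (hsub2.trans hsub).trans hbΩ, ?_⟩
  · refine (conv_smooth hK.sρ hK.cρ hU hS9).continuous.sub ?_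
    rw [continuous_iff_continuousAt]
    exact fun x => (A_hasFDerivAt hK hF2m hF2 hF2D _ x).continuousAt
  · filter_upwards [R2, hUu2] with x h1 h2 hb
    rw [← h1 hb, h2 (hsub2 hb)]

lemma ae_ball_eq {f g : Eu m → ℝ} {s : Set (Eu m)} (hs : IsOpen s) (h : ∀ᵐ x, x ∈ s → f x = g x)
    (hf : ContinuousOn f s) (hg : ContinuousOn g s) : ∀ x ∈ s, f x = g x := by
  apply Measure.eqOn_open_of_ae_eq (μ := volume) _ hs hf hg
  exact (ae_restrict_iff' hs.measurableSet).2 h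

lemma patch {Ω : Set (Eu m)} {u : Eu m → ℝ}
    (h : ∀ x0 ∈ Ω, ∃ s : ℝ, ∃ w : Eu m → ℝ, 0 < s ∧ Continuous w ∧ Metric.ball x0 s ⊆ Ω ∧
      ∀ᵐ x, x ∈ Metric.ball x0 s → u x = w x) :
    ∃ v : Eu m → ℝ, ContinuousOn v Ω ∧ ∀ᵐ x, x ∈ Ω → u x = v x := by
  choose! s w hs hw hb hae using h
  have key : ∀ x ∈ Ω, ∀ y ∈ Metric.ball x (s x), w y y = w x y := by
    intro x hx y hy
    have hyΩ := hb x hx hy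
    apply ae_ball_eq (s := Metric.ball x (s x) ∩ Metric.ball y (s y)) 
      (Metric.isOpen_ball.inter Metric.isOpen_ball)
    · filter_upwards [hae x hx, hae y hyΩ] with z h1 h2 hz
      rw [← h1 hz.1, h2 hz.2]
    · exact (hw y hyΩ).continuousOn
    · exact (hw x hx).continuousOn
    · exact ⟨hy, Metric.mem_ball_self (hs y hyΩ)⟩
  refine ⟨fun x => w x x, ?_, ?_⟩
  · intro x hx
    apply ContinuousAt.continuousWithinAt
    refine (hw x hx).continuousAt.congr ?_
    filter_upwards [Metric.ball_mem_nhds x (hs x hx)] with y hy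
    exact (key x hx y hy).symm
  · have : volume {x | x ∈ Ω ∧ u x ≠ w x x} = 0 := by
      apply measure_null_of_locally_null
      intro x hx
      refine ⟨{y | ¬ (y ∈ Metric.ball x (s x) → u y = w x y)} ∩ Metric.ball x (s x) ∪
        {y | ¬ (y ∈ Metric.ball x (s x) → u y = w x y)}, ?_, ?_⟩
      · rw [mem_nhdsWithin]
        refine ⟨Metric.ball x (s x), Metric.isOpen_ball, Metric.mem_ball_self (hs x hx.1), ?_⟩
        rintro y ⟨hy, hyΩ, hne⟩
        right
        intro hh
        exact hne ((hh hy).trans (key x hx.1 y hy).symm)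
      · have h0 : volume {y | ¬ (y ∈ Metric.ball x (s x) → u y = w x y)} = 0 :=
          ae_iff.1 (hae x hx.1)
        exact measure_mono_null (Set.union_subset Set.inter_subset_left le_rfl) h0
    rw [ae_iff]
    simpa using this

lemma cutoff {Ω : Set (Eu m)} (hΩ : IsOpen Ω) {f : Eu m → ℝ} {n : WithTop ℕ∞}
    (hn : n ≤ ((⊤ : ℕ∞) : WithTop ℕ∞)) (hf : ContDiffOn ℝ n f Ω) {x0 : Eu m} (hx0 : x0 ∈ Ω) :
    ∃ S : ℝ, 0 < S ∧ Metric.ball x0 S ⊆ Ω ∧ ∃ V : Eu m → ℝ, ContDiff ℝ n V ∧ HasCompactSupport V ∧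
      ∀ x ∈ Metric.ball x0 S, V x = f x := by
  obtain ⟨S, hS, hSΩ⟩ := Metric.nhds_basis_closedBall.mem_iff.1 (hΩ.mem_nhds hx0)
  let b : ContDiffBump x0 := ⟨S/2, S, by linarith, by linarith⟩
  have hbt : tsupport b = Metric.closedBall x0 S := b.tsupport_eq
  have hbs : ContDiff ℝ n b := b.contDiff.of_le hn
  refine ⟨S/2, by linarith, ?_, fun x => b x * f x, ?_, ?_, ?_⟩
  · exact (Metric.ball_subset_ball (by linarith)).trans (Metric.ball_subset_closedBall.trans hSΩ)
  · rw [contDiff_iff_contDiffAt]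
    intro x
    by_cases hx : x ∈ Ω
    · exact hbs.contDiffAt.mul (hf.contDiffAt (hΩ.mem_nhds hx))
    · have hx' : x ∉ tsupport b := by
        rw [hbt]
        exact fun h => hx (hSΩ h)
      refine (contDiffAt_const (c := (0 : ℝ))).congr_of_eventuallyEq ?_
      filter_upwards [(notMem_tsupport_iff_eventuallyEq.1 hx')] with y hy
      simp [hy]
  · exact b.hasCompactSupport.mul_right
  · intro x hx
    have : b x = 1 := b.one_of_mem_closedBall (Metric.ball_subset_closedBall hx)
    simp [this]

lemma cutoff_pair {Ω : Set (Eu m)} (hΩ : IsOpen Ω) {v : Eu m → ℝ} {c : ℝ} {n : WithTop ℕ∞}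
    (hn : n ≤ ((⊤ : ℕ∞) : WithTop ℕ∞)) (hf : ContDiffOn ℝ n v Ω) {x0 : Eu m} (hx0 : x0 ∈ Ω) :
    ∃ S : ℝ, 0 < S ∧ Metric.ball x0 S ⊆ Ω ∧ ∃ V F : Eu m → ℝ, ContDiff ℝ n V ∧
      HasCompactSupport V ∧ ContDiff ℝ n F ∧ HasCompactSupport F ∧
      (∀ x ∈ Metric.ball x0 S, V x = v x) ∧ ∀ x ∈ Metric.ball x0 S, F x = Real.exp (c * v x) := by
  obtain ⟨S, hS, hb, V, hV, hVc, hVe⟩ := cutoff hΩ hn hf hx0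
  obtain ⟨S', hS', hb', F, hF, hFc, hFe⟩ := cutoff hΩ hn ((contDiffOn_const (c := c)).mul hf).exp hx0
  refine ⟨min S S', lt_min hS hS', (Metric.ball_subset_ball (min_le_left _ _)).trans hb, V, F, hV,
    hVc, hF, hFc, fun x hx => hVe x (Metric.ball_subset_ball (min_le_left _ _) hx),
    fun x hx => hFe x (Metric.ball_subset_ball (min_le_right _ _) hx)⟩

lemma boot {ψ ρ : Eu m → ℝ} (hK : IsKer ψ ρ) {Ω : Set (Eu m)} (hΩ : IsOpen Ω) {c : ℝ}
    {u v : Eu m → ℝ} (hw : IsWeakSol u (fun x => Real.exp (c * u x)) Ω)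
    (huv : ∀ᵐ x, x ∈ Ω → u x = v x) (hv : ContinuousOn v Ω) (n : ℕ) : ContDiffOn ℝ n v Ω := by
  induction n with
  | zero => simpa using hv
  | succ n ih =>
    intro x0 hx0
    apply ContDiffAt.contDiffWithinAt
    have hn : (n : WithTop ℕ∞) ≤ ((⊤ : ℕ∞) : WithTop ℕ∞) := by exact_mod_cast le_top
    obtain ⟨S, hS, hb, V, F, hV, hVc, hF, hFc, hVe, hFe⟩ := cutoff_pair (c := c) hΩ hn ih hx0
    have hVu : ∀ᵐ x, x ∈ Metric.ball x0 S → V x = u x := by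
      filter_upwards [huv] with x hx hxb
      rw [hVe x hxb, hx (hb hxb)]
    have hFu : ∀ᵐ x, x ∈ Metric.ball x0 S → F x = Real.exp (c * u x) := by
      filter_upwards [huv] with x hx hxb
      rw [hFe x hxb, hx (hb hxb)]
    have cV := hV.continuous
    have cF := hF.continuous
    have iV := cV.integrable_of_hasCompactSupport hVc (μ := volume)
    have iF := cF.integrable_of_hasCompactSupport hFc (μ := volume)
    have hS3 : 0 < S / 3 := by linarith
    have R := rep hK cV.measurable iV cF.measurable iF hS (weak_local hw hb hVu hFu) hS3 le_rfl
    have hsm : ContDiff ℝ (n + 1) (fun x => (∫ y, ρ y * V (x - (S/3) • y)) -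
        ∫ p, (p.1 * ψ p.2) * F (x - p.1 • p.2) ∂(pm m (S/3))) :=
      ((conv_smooth hK.sρ hK.cρ iV hS3).of_le (by exact_mod_cast le_top)).sub
        (A_contDiff hK hF hFc (S/3))
    have E := ae_ball_eq Metric.isOpen_ball R cV.continuousOn hsm.continuous.continuousOn
    push_cast
    refine hsm.contDiffAt.congr_of_eventuallyEq ?_
    filter_upwards [Metric.ball_mem_nhds x0 hS3] with x hx
    rw [← E x hx, hVe x (Metric.ball_subset_ball (by linarith) hx)]

lemma classical {Ω : Set (Eu m)} (hΩ : IsOpen Ω) {c : ℝ}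
    {u v : Eu m → ℝ} (hw : IsWeakSol u (fun x => Real.exp (c * u x)) Ω)
    (huv : ∀ᵐ x, x ∈ Ω → u x = v x) (hv : ContDiffOn ℝ (⊤ : ℕ∞) v Ω) {x0 : Eu m} (hx0 : x0 ∈ Ω) :
    lap v x0 = Real.exp (c * v x0) := by
  obtain ⟨S, hS, hb, V, F, hV, hVc, hF, hFc, hVe, hFe⟩ := cutoff_pair (c := c) hΩ le_rfl hv hx0
  have hVu : ∀ᵐ x, x ∈ Metric.ball x0 S → V x = u x := by
    filter_upwards [huv] with x hx hxb
    rw [hVe x hxb, hx (hb hxb)]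
  have hFu : ∀ᵐ x, x ∈ Metric.ball x0 S → F x = Real.exp (c * u x) := by
    filter_upwards [huv] with x hx hxb
    rw [hFe x hxb, hx (hb hxb)]
  have cl := lap_continuous hV
  have cF := hF.continuous
  have main := (Metric.isOpen_ball (x := x0) (ε := S)).ae_eq_zero_of_integral_contDiff_smul_eq_zero
    (f := fun x => lap V x - F x) (μ := volume)
    ((cl.sub cF).locallyIntegrable.locallyIntegrableOn _) ?_
  · have E := ae_ball_eq Metric.isOpen_ball main (cl.sub cF).continuousOn continuousOn_const x0
      (Metric.mem_ball_self hS)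
    have e1 : v =ᶠ[nhds x0] V := by
      filter_upwards [Metric.ball_mem_nhds x0 hS] with x hx
      exact (hVe x hx).symm
    have e2 : lap v x0 = lap V x0 := by
      unfold lap
      rw [e1.fderiv.fderiv_eq]
    rw [e2, ← hFe x0 (Metric.mem_ball_self hS)]
    linarith
  intro g hg hgc hgs
  have cg := hg.continuous
  have h := weak_local hw hb hVu hFu g hg hgc hgs
  rw [green hV hg hVc hgc] at h
  have i1 : Integrable (fun x => lap V x * g x) :=
    Continuous.integrable_of_hasCompactSupport (by fun_prop) hgc.mul_left
  have i2 : Integrable (fun x => F x * g x) :=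
    Continuous.integrable_of_hasCompactSupport (by fun_prop) hgc.mul_left
  have e : ∀ x, g x • (lap V x - F x) = lap V x * g x - F x * g x := by
    intro x; rw [smul_eq_mul]; ring
  simp_rw [e]
  rw [integral_sub i1 i2, h, sub_self]
end Main

/-- every weak solution of `Δu = e^{cu}` (`c > 0`) on a domain `Ω`
agrees a.e. with a smooth function on `Ω` that solves the equation classically. -/
theorem stmt19 {m : ℕ}
    (Ω : Set (EuclideanSpace ℝ (Fin m))) (hΩo : IsOpen Ω) (hΩc : IsConnected Ω)
    (c : ℝ) (hcpos : 0 < c)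
    (u : EuclideanSpace ℝ (Fin m) → ℝ)
    (hweak : IsWeakSol u (fun x => Real.exp (c * u x)) Ω) :
    ∃ v : EuclideanSpace ℝ (Fin m) → ℝ, ContDiffOn ℝ (⊤ : ℕ∞) v Ω ∧
      (∀ᵐ x ∂(volume.restrict Ω), u x = v x) ∧
      ∀ x ∈ Ω, lap v x = Real.exp (c * v x) := by
  obtain ⟨ψ, ρ, h1, h2, h3, h4, h5, h6, h7⟩ := exists_kernel m
  have hK : IsKer ψ ρ := ⟨h1, h2, h3, h4, h5, h6, h7⟩
  obtain ⟨v, hv, huv⟩ := patch (local_cont hK hΩo hcpos hweak)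
  have hs : ContDiffOn ℝ (⊤ : ℕ∞) v Ω := by
    rw [contDiffOn_infty]
    exact fun n => boot hK hΩo hweak huv hv n
  exact ⟨v, hs, (ae_restrict_iff' hΩo.measurableSet).2 huv,
    fun x hx => classical hΩo hweak huv hs hx⟩
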